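/- Let Ω ⊆ ℍ be a symmetric slice domain and let f₁, …, fₙ : Ω → ℍ be slice regular functions with no common zeros, i.e. for every q ∈ Ω there exists ℓ with f_ℓ(q) ≠ 0. Fix I, J ∈ 𝕊 with IJ = −JI and holomorphic functions F_ℓ, G_ℓ : Ω_I → L_I with f_ℓ(z) = F_ℓ(z) + G_ℓ(z)J for all z ∈ Ω_I (ℓ = 1, …, n). Then there exist holomorphic functions H_ℓ, K_ℓ : Ω_I → L_I (ℓ = 1, …, n) such that on all of Ω_I: Σ_{ℓ=1}^{n} (F_ℓ H_ℓ − G_ℓ K̂_ℓ) = 1 and Σ_{ℓ=1}^{n} (F_ℓ K_ℓ + G_ℓ Ĥ_ℓ) = 0. -/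

import Mathlib

noncomputable section

/-- The 2-sphere of quaternionic imaginary units. -/
def QSphere : Set (Quaternion ℝ) := {q | q ^ 2 = -1}

/-- The complex plane `L_I = ℝ + ℝI` through an imaginary unit `I`. -/
def sliceL (I : Quaternion ℝ) : Set (Quaternion ℝ) :=
  {q | ∃ x y : ℝ, q = (x : Quaternion ℝ) + (y : Quaternion ℝ) * I}

/-- The planar parametrization of the restriction of `f` to the slice `L_I`. -/
def sliceMap (f : Quaternion ℝ → Quaternion ℝ) (I : Quaternion ℝ) : ℝ × ℝ → Quaternion ℝ :=
  fun p => f ((p.1 : Quaternion ℝ) + (p.2 : Quaternion ℝ) * I)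

/-- `f` is holomorphic (has continuous partial derivatives and satisfies
`(∂/∂x + I ∂/∂y) f = 0`) at the points of `U` lying in the slice `L_I`. -/
def HoloSlice (f : Quaternion ℝ → Quaternion ℝ) (I : Quaternion ℝ)
    (U : Set (Quaternion ℝ)) : Prop :=
  ∀ x y : ℝ, (x : Quaternion ℝ) + (y : Quaternion ℝ) * I ∈ U →
    ContDiffAt ℝ 1 (sliceMap f I) (x, y) ∧
    fderiv ℝ (sliceMap f I) (x, y) (1, 0) + I * fderiv ℝ (sliceMap f I) (x, y) (0, 1) = 0

/-- `f` is slice regular on `Ω`. -/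
def SliceRegularOn (f : Quaternion ℝ → Quaternion ℝ) (Ω : Set (Quaternion ℝ)) : Prop :=
  ∀ I ∈ QSphere, HoloSlice f I Ω

/-- `Ω` is a symmetric slice domain. -/
def IsSymmSliceDomain (Ω : Set (Quaternion ℝ)) : Prop :=
  IsOpen Ω ∧ IsConnected Ω ∧ (∃ x : ℝ, (x : Quaternion ℝ) ∈ Ω) ∧
  (∀ I ∈ QSphere, IsConnected (Ω ∩ sliceL I)) ∧
  (∀ x y : ℝ, ∀ I ∈ QSphere, (x : Quaternion ℝ) + (y : Quaternion ℝ) * I ∈ Ω →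
    ∀ J ∈ QSphere, (x : Quaternion ℝ) + (y : Quaternion ℝ) * J ∈ Ω)


/-- The identification of `ℂ` with the slice `L_I = ℝ + ℝI`: `x + yi ↦ x + yI`. -/
def toSlice (I : Quaternion ℝ) (w : ℂ) : Quaternion ℝ :=
  (w.re : Quaternion ℝ) + (w.im : Quaternion ℝ) * I

/-- The hat operation `Ĥ(z) = conj (H (z̄))`. -/
def hatC (H : ℂ → ℂ) (w : ℂ) : ℂ := starRingEnd ℂ (H (starRingEnd ℂ w))

open Filter Topology

/-- Taylor expansion with an analytic remainder and an entire principal term. -/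
lemma AnalyticAt.exists_entire_add_pow_mul {ψ : ℂ → ℂ} {ζ : ℂ} (hψ : AnalyticAt ℂ ψ ζ) (n : ℕ) :
    ∃ p r : ℂ → ℂ, Differentiable ℂ p ∧ AnalyticAt ℂ r ζ ∧
      ∀ z, ψ z = p z + (z - ζ) ^ n * r z := by
  induction n with
  | zero => exact ⟨0, ψ, differentiable_const 0, hψ, fun z => by simp⟩
  | succ n ih =>
    obtain ⟨p, r, hp, hr, h⟩ := ih
    obtain ⟨q, hq⟩ := hr
    refine ⟨fun z => p z + (z - ζ) ^ n * r ζ, dslope r ζ, by fun_prop,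
      ⟨_, hq.has_fpower_series_dslope_fslope⟩, fun z => ?_⟩
    have := sub_smul_dslope r ζ z
    rw [smul_eq_mul] at this
    rw [h z, pow_succ, mul_assoc, this]
    ring

/-- Existence of principal parts at a pole. -/
lemma MeromorphicAt.exists_principalPart {φ : ℂ → ℂ} {ζ : ℂ} (hφ : MeromorphicAt φ ζ) :
    ∃ (n : ℕ) (p r : ℂ → ℂ), Differentiable ℂ p ∧ AnalyticAt ℂ r ζ ∧
      ∀ z ≠ ζ, φ z = p z / (z - ζ) ^ n + r z := by
  obtain ⟨n, hn⟩ := hφ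
  obtain ⟨p, r, hp, hr, h⟩ := hn.exists_entire_add_pow_mul n
  refine ⟨n, p, r, hp, hr, fun z hz => ?_⟩
  have hz' : (z - ζ) ^ n ≠ 0 := pow_ne_zero _ (sub_ne_zero.2 hz)
  have := h z
  rw [smul_eq_mul] at this
  field_simp
  linear_combination this

/-- A principal part can be damped on any set where a suitable multiplier is small. -/
lemma MeromorphicAt.exists_small_principalPart {D K : Set ℂ} {φ h : ℂ → ℂ} {ζ : ℂ}
    (hD : IsOpen D) (hζ : ζ ∈ D) (hφ : MeromorphicAt φ ζ) (hh : DifferentiableOn ℂ h D)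
    (h1 : h ζ = 1) (hK : IsCompact K) (hsmall : ∀ z ∈ K, ‖h z‖ ≤ 1 / 2)
    {ε : ℝ} (hε : 0 < ε) :
    ∃ T : ℂ → ℂ, DifferentiableOn ℂ T (D \ {ζ}) ∧
      (∃ r, AnalyticAt ℂ r ζ ∧ ∀ᶠ z in 𝓝[≠] ζ, T z = φ z + r z) ∧ ∀ z ∈ K, ‖T z‖ ≤ ε := by
  obtain ⟨n, p, r, hp, hr, hpr⟩ := hφ.exists_principalPart
  have hζK : ∀ z ∈ K, z - ζ ≠ 0 := fun z hz h0 => by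
    have := hsmall z hz
    rw [sub_eq_zero.1 h0, h1] at this
    norm_num at this
  obtain ⟨C, hC⟩ := hK.exists_bound_of_continuousOn (f := fun z => p z / (z - ζ) ^ n)
    (hp.continuous.continuousOn.div (by fun_prop) fun z hz => pow_ne_zero _ (hζK z hz))
  have hcont : Tendsto (fun t : ℂ => 1 - (1 - t) ^ n) (𝓝 0) (𝓝 0) := by
    have : Continuous fun t : ℂ => 1 - (1 - t) ^ n := by fun_prop
    simpa using this.tendsto 0
  obtain ⟨δ, hδ, hδ'⟩ := Metric.tendsto_nhds_nhds.1 hcont (ε / (|C| + 1)) (by positivity)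
  obtain ⟨N, hN⟩ := exists_pow_lt_of_lt_one hδ (by norm_num : (1 / 2 : ℝ) < 1)
  refine ⟨fun z => p z / (z - ζ) ^ n * (1 - (1 - h z ^ N) ^ n), ?_, ?_, ?_⟩
  · refine DifferentiableOn.mul (hp.differentiableOn.div (by fun_prop) fun z hz =>
      pow_ne_zero _ (sub_ne_zero.2 hz.2)) ?_
    have := hh.mono (Set.sdiff_subset (t := {ζ}))
    fun_prop
  · have hha : AnalyticAt ℂ (fun z => 1 - h z ^ N) ζ := by
      have := hh.analyticAt (hD.mem_nhds hζ)
      fun_prop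
    obtain ⟨q, hq⟩ := hha
    have hs : AnalyticAt ℂ (dslope (fun z => 1 - h z ^ N) ζ) ζ :=
      ⟨_, hq.has_fpower_series_dslope_fslope⟩
    have hpa : AnalyticAt ℂ p ζ := hp.analyticAt ζ
    refine ⟨fun z => -(p z * dslope (fun z => 1 - h z ^ N) ζ z ^ n) - r z, by fun_prop, ?_⟩
    filter_upwards [self_mem_nhdsWithin] with z hz
    have hz' : (z - ζ) ^ n ≠ 0 := pow_ne_zero _ (sub_ne_zero.2 hz)
    have hd := sub_smul_dslope (fun z => 1 - h z ^ N) ζ z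
    simp only [smul_eq_mul, h1, one_pow, sub_self, sub_zero] at hd
    rw [hpr z hz, ← hd, mul_pow]
    field_simp
    ring
  · intro z hz
    have hsm : ‖1 - (1 - h z ^ N) ^ n‖ < ε / (|C| + 1) := by
      have := @hδ' (h z ^ N) (by
        rw [dist_zero_right, norm_pow]
        exact (pow_le_pow_left₀ (norm_nonneg _) (hsmall z hz) N).trans_lt hN)
      rwa [dist_zero_right] at this
    rw [norm_mul]
    calc _ ≤ (|C| + 1) * (ε / (|C| + 1)) := by
          refine mul_le_mul ?_ hsm.le (norm_nonneg _) (by positivity)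
          linarith [hC z hz, le_abs_self C]
      _ = ε := by field_simp

/-- A compact exhaustion of an open set of the plane. -/
def planeExhaustion (D : Set ℂ) (k : ℕ) : Set ℂ :=
  {z | ‖z‖ ≤ k ∧ ∀ c ∉ D, 1 / ((k : ℝ) + 1) ≤ ‖z - c‖}

lemma planeExhaustion_subset (D : Set ℂ) (k : ℕ) : planeExhaustion D k ⊆ D := by
  intro z hz
  by_contra h
  have := hz.2 z h
  rw [sub_self, norm_zero] at this
  have : (0 : ℝ) < 1 / ((k : ℝ) + 1) := by positivity
  linarith

lemma planeExhaustion_mono (D : Set ℂ) : Monotone (planeExhaustion D) := by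
  intro k l hkl z hz
  have hkl' : (k : ℝ) ≤ l := by exact_mod_cast hkl
  refine ⟨hz.1.trans hkl', fun c hc => le_trans ?_ (hz.2 c hc)⟩
  gcongr

lemma isCompact_planeExhaustion (D : Set ℂ) (k : ℕ) : IsCompact (planeExhaustion D k) := by
  refine (isCompact_closedBall (0 : ℂ) k).of_isClosed_subset ?_ fun z hz => by simpa using hz.1
  simp only [planeExhaustion, Set.ofPred_and, Set.ofPred_forall]
  refine (isClosed_le (by fun_prop) (by fun_prop)).inter ?_
  exact isClosed_iInter fun c => isClosed_iInter fun _ => isClosed_le (by fun_prop) (by fun_prop)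

lemma exists_planeExhaustion_mem_nhds {D : Set ℂ} (hD : IsOpen D) {z : ℂ} (hz : z ∈ D) :
    ∃ k, planeExhaustion D k ∈ 𝓝 z := by
  obtain ⟨δ, hδ, hball⟩ := Metric.isOpen_iff.1 hD z hz
  obtain ⟨k, hk⟩ := exists_nat_gt (‖z‖ + δ + 2 / δ)
  have hdiv : 0 < 2 / δ := by positivity
  refine ⟨k, mem_of_superset (Metric.ball_mem_nhds z (half_pos hδ)) fun w hw => ⟨?_, fun c hc => ?_⟩⟩
  · rw [mem_ball_iff_norm] at hw
    have := norm_le_norm_add_norm_sub' w z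
    linarith
  · have h1 : δ ≤ ‖c - z‖ := by
      by_contra hlt
      exact hc (hball (mem_ball_iff_norm.2 (not_le.1 hlt)))
    rw [mem_ball_iff_norm] at hw
    have h2 : ‖c - z‖ ≤ ‖w - c‖ + ‖w - z‖ := by
      have := norm_sub_le (w - z) (w - c)
      rw [sub_sub_sub_cancel_left] at this
      linarith
    have h3 : 1 / ((k : ℝ) + 1) ≤ δ / 2 := by
      rw [div_le_iff₀ (by positivity)]
      have : 2 / δ < k + 1 := by linarith [norm_nonneg z]
      rw [div_lt_iff₀ hδ] at this
      linarith
    linarith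

/-- Points of `D` far out in the exhaustion are separated from earlier stages by a multiplier. -/
lemma exists_multiplier {D : Set ℂ} {k : ℕ} {ζ : ℂ} (hζ : ζ ∈ D)
    (hk : ζ ∉ planeExhaustion D (2 * k + 2)) :
    ∃ h : ℂ → ℂ, DifferentiableOn ℂ h D ∧ h ζ = 1 ∧ ∀ z ∈ planeExhaustion D k, ‖h z‖ ≤ 1 / 2 := by
  by_cases hn : ‖ζ‖ ≤ ((2 * k + 2 : ℕ) : ℝ)
  · obtain ⟨c, hc, hlt⟩ : ∃ c ∉ D, ‖ζ - c‖ < 1 / (((2 * k + 2 : ℕ) : ℝ) + 1) := by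
      by_contra! hcon
      exact hk ⟨hn, hcon⟩
    have hne : ∀ z ∈ D, z - c ≠ 0 := fun z hz h0 => hc (sub_eq_zero.1 h0 ▸ hz)
    refine ⟨fun z => (ζ - c) / (z - c), by fun_prop (disch := assumption), div_self (hne ζ hζ),
      fun z hz => ?_⟩
    have hzc := hz.2 c hc
    have hpos : 0 < 1 / ((k : ℝ) + 1) := by positivity
    rw [norm_div, div_le_iff₀ (hpos.trans_le hzc)]
    have : 1 / (((2 * k + 2 : ℕ) : ℝ) + 1) ≤ 1 / 2 * (1 / ((k : ℝ) + 1)) := by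
      rw [one_div_mul_one_div]
      push_cast
      gcongr
      linarith
    linarith
  · push Not at hn
    push_cast at hn
    have hk0 : (0 : ℝ) ≤ k := k.cast_nonneg
    have hpos : 0 < ‖ζ‖ := by linarith
    refine ⟨fun z => z / ζ, by fun_prop, div_self (norm_pos_iff.1 hpos), fun z hz => ?_⟩
    rw [norm_div, div_le_iff₀ hpos]
    linarith [hz.1]

/-- **Mittag-Leffler theorem** on an open subset of the plane. -/
theorem exists_mittagLeffler {D Z : Set ℂ} (hD : IsOpen D) (hZD : Z ⊆ D) (hZc : Z.Countable)
    (hZ : Zᶜ ∈ codiscreteWithin D) {φ : ℂ → ℂ} (hφ : ∀ ζ ∈ Z, MeromorphicAt φ ζ) :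
    ∃ m : ℂ → ℂ, (∀ z ∈ D \ Z, AnalyticAt ℂ m z) ∧
      ∀ ζ ∈ Z, ∃ r, AnalyticAt ℂ r ζ ∧ ∀ᶠ z in 𝓝[≠] ζ, m z = φ z + r z := by
  classical
  obtain ⟨e, he⟩ := hZc.exists_injective_nat'
  set good : ℕ → ℂ → Prop := fun k ζ => ∃ h : ℂ → ℂ, DifferentiableOn ℂ h D ∧ h ζ = 1 ∧
    ∀ z ∈ planeExhaustion D k, ‖h z‖ ≤ 1 / 2 with hgood
  have hT : ∀ ζ : Z, ∃ T : ℂ → ℂ, DifferentiableOn ℂ T (D \ {ζ.1}) ∧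
      (∃ r, AnalyticAt ℂ r ζ.1 ∧ ∀ᶠ z in 𝓝[≠] ζ.1, T z = φ z + r z) ∧
      ∀ k ≤ e ζ, good k ζ → ∀ z ∈ planeExhaustion D k, ‖T z‖ ≤ (1 / 2) ^ e ζ := by
    intro ζ
    have hε : (0 : ℝ) < (1 / 2) ^ e ζ := by positivity
    by_cases hex : ∃ k ≤ e ζ, good k ζ
    · obtain ⟨k, hk, hgk⟩ := hex
      obtain ⟨h, hh, h1, hs⟩ := Nat.findGreatest_spec (P := fun k => good k ζ) hk hgk
      obtain ⟨T, hT1, hT2, hT3⟩ := (hφ ζ ζ.2).exists_small_principalPart hD (hZD ζ.2) hh h1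
        (isCompact_planeExhaustion D _) hs hε
      exact ⟨T, hT1, hT2, fun l hl hgl z hz =>
        hT3 z (planeExhaustion_mono D (Nat.le_findGreatest hl hgl) hz)⟩
    · obtain ⟨T, hT1, hT2, -⟩ := (hφ ζ ζ.2).exists_small_principalPart (h := fun _ => 1)
        hD (hZD ζ.2) (by fun_prop) rfl isCompact_empty (by simp) hε
      exact ⟨T, hT1, hT2, fun k hk hgk => absurd ⟨k, hk, hgk⟩ hex⟩
  choose T hTd hTr hTb using hT
  have hsum : Summable fun ζ : Z => (1 / 2 : ℝ) ^ e ζ := summable_geometric_two.comp_injective he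
  have hfin : ∀ k, {ζ : Z | ¬(k ≤ e ζ ∧ good k ζ)}.Finite := by
    intro k
    have h1 : {ζ : Z | e ζ < k}.Finite := (Set.finite_lt_nat k).preimage he.injOn
    have h2 : {ζ : Z | ζ.1 ∈ planeExhaustion D (2 * k + 2)}.Finite := by
      have hK := isCompact_planeExhaustion D (2 * k + 2)
      have := hK.finite_sdiff_of_mem_codiscreteWithin
        (codiscreteWithin_mono (planeExhaustion_subset D (2 * k + 2)) hZ)
      refine (this.preimage Subtype.val_injective.injOn).subset fun ζ hζ => ⟨hζ, by simp⟩
    refine (h1.union h2).subset fun ζ hζ => ?_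
    by_contra hcon
    simp only [Set.mem_union, Set.mem_ofPred_eq, not_or, not_lt] at hcon
    exact hζ ⟨hcon.1, exists_multiplier (hZD ζ.2) hcon.2⟩
  -- the local structure of the sum: finitely many terms plus an analytic tail
  have key : ∀ z ∈ D, ∃ B₀ : Finset Z, ∀ B ⊇ B₀, ∃ t : ℂ → ℂ, AnalyticAt ℂ t z ∧
      ∀ᶠ w in 𝓝 z, ∑' ζ, T ζ w = ∑ ζ ∈ B, T ζ w + t w := by
    intro z hz
    obtain ⟨k, hk⟩ := exists_planeExhaustion_mem_nhds hD hz
    refine ⟨(hfin k).toFinset, fun B hB => ⟨fun w => ∑' ζ : {ζ // ζ ∉ B}, T ζ.1 w, ?_, ?_⟩⟩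
    · have hBg : ∀ ζ : {ζ // ζ ∉ B}, k ≤ e ζ ∧ good k ζ.1 := fun ζ => by
        by_contra hcon
        exact ζ.2 (hB ((hfin k).mem_toFinset.2 hcon))
      refine (Complex.differentiableOn_tsum_of_summable_norm (hsum.subtype fun ζ => ζ ∉ B)
        (fun ζ => (hTd ζ.1).mono fun w hw => ?_) isOpen_interior
        fun ζ w hw => hTb ζ.1 k (hBg ζ).1 (hBg ζ).2 w (interior_subset hw)).analyticAt
        (isOpen_interior.mem_nhds (mem_interior_iff_mem_nhds.2 hk))
      have hwK := interior_subset hw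
      refine ⟨planeExhaustion_subset D k hwK, fun hwζ => ?_⟩
      obtain ⟨h, -, h1, hs⟩ := (hBg ζ).2
      have := hs w hwK
      rw [Set.mem_singleton_iff.1 hwζ, h1] at this
      norm_num at this
    · filter_upwards [hk] with w hw
      refine (Summable.sum_add_tsum_subtype_compl (f := fun ζ => T ζ w) ?_ B).symm
      refine Summable.of_norm_bounded_eventually hsum ?_
      refine (hfin k).subset fun ζ hζ hcon => hζ (hTb ζ k hcon.1 hcon.2 w hw)
  have hTa : ∀ ζ : Z, ∀ z ∈ D, z ≠ ζ → AnalyticAt ℂ (T ζ) z := fun ζ z hz hne =>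
    (hTd ζ).analyticAt ((hD.sdiff isClosed_singleton).mem_nhds ⟨hz, hne⟩)
  refine ⟨fun w => ∑' ζ, T ζ w, fun z hz => ?_, fun ζ hζ => ?_⟩
  · obtain ⟨B, hB⟩ := key z hz.1
    obtain ⟨t, ht, hev⟩ := hB B subset_rfl
    refine AnalyticAt.congr ?_ (EventuallyEq.symm hev)
    refine (Finset.analyticAt_fun_sum B fun ζ _ => hTa ζ z hz.1 ?_).add ht
    rintro rfl
    exact hz.2 ζ.2
  · obtain ⟨B₀, hB⟩ := key ζ (hZD hζ)
    obtain ⟨t, ht, hev⟩ := hB (insert ⟨ζ, hζ⟩ B₀) (Finset.subset_insert _ _)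
    obtain ⟨r, hr, hrev⟩ := hTr ⟨ζ, hζ⟩
    refine ⟨fun w => r w + (∑ x ∈ (insert ⟨ζ, hζ⟩ B₀).erase ⟨ζ, hζ⟩, T x w + t w), ?_, ?_⟩
    · refine hr.add ((Finset.analyticAt_fun_sum _ fun x hx => hTa x ζ (hZD hζ) ?_).add ht)
      rintro rfl
      exact (Finset.mem_erase.1 hx).1 rfl
    · filter_upwards [hrev, hev.filter_mono nhdsWithin_le_nhds] with w h1 h2
      rw [h2, ← Finset.add_sum_erase _ _ (Finset.mem_insert_self _ _), h1]
      ring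

/-- Removal of isolated singularities that are removable at every point of `D`. -/
lemma exists_differentiableOn_of_punctured {D : Set ℂ} {a₀ : ℂ → ℂ}
    (h : ∀ z ∈ D, ∃ ψ, AnalyticAt ℂ ψ z ∧ ∀ᶠ w in 𝓝[≠] z, a₀ w = ψ w) :
    ∃ a : ℂ → ℂ, DifferentiableOn ℂ a D ∧ ∀ z ∈ D, ∀ᶠ w in 𝓝[≠] z, a w = a₀ w := by
  have hlim : ∀ {ψ : ℂ → ℂ} {w : ℂ}, ContinuousAt ψ w → (∀ᶠ v in 𝓝[≠] w, a₀ v = ψ v) →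
      limUnder (𝓝[≠] w) a₀ = ψ w := fun {ψ w} hψ hev =>
    Tendsto.limUnder_eq ((hψ.tendsto.mono_left nhdsWithin_le_nhds).congr' (EventuallyEq.symm hev))
  have key : ∀ z ∈ D, ∃ ψ, AnalyticAt ℂ ψ z ∧ (∀ᶠ w in 𝓝[≠] z, a₀ w = ψ w) ∧
      ∀ᶠ w in 𝓝 z, limUnder (𝓝[≠] w) a₀ = ψ w := by
    intro z hz
    obtain ⟨ψ, hψ, hev⟩ := h z hz
    refine ⟨ψ, hψ, hev, ?_⟩
    have h1 := eventually_eventually_nhdsWithin.2 hev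
    rw [eventually_nhdsWithin_iff] at h1
    filter_upwards [h1, hψ.eventually_continuousAt] with w hw hc
    by_cases hwz : w = z
    · subst hwz
      exact hlim hc hev
    · refine hlim hc ?_
      have h2 := hw hwz
      rw [(isOpen_compl_singleton (x := z)).nhdsWithin_eq hwz] at h2
      exact h2.filter_mono nhdsWithin_le_nhds
  refine ⟨fun w => limUnder (𝓝[≠] w) a₀, fun z hz => ?_, fun z hz => ?_⟩
  · obtain ⟨ψ, hψ, -, hev⟩ := key z hz
    exact (hψ.differentiableAt.congr_of_eventuallyEq hev).differentiableWithinAt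
  · obtain ⟨ψ, -, hev, hev'⟩ := key z hz
    filter_upwards [hev, hev'.filter_mono nhdsWithin_le_nhds] with w h1 h2
    rw [h1, h2]

lemma countable_of_compl_mem_codiscreteWithin {D Z : Set ℂ} (hZD : Z ⊆ D)
    (hZ : Zᶜ ∈ codiscreteWithin D) : Z.Countable := by
  have := isDiscrete_of_codiscreteWithin hZ
  rw [Set.inter_eq_left.2 hZD] at this
  have := this.to_subtype
  exact Set.countable_coe_iff.1 countable_of_Lindelof_of_discrete

/-- Two holomorphic functions without common zeros generate the unit ideal. -/
theorem exists_bezout_pair {D : Set ℂ} (hD : IsOpen D) {f g : ℂ → ℂ}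
    (hf : DifferentiableOn ℂ f D) (hg : DifferentiableOn ℂ g D)
    (hZ : {z ∈ D | g z = 0}ᶜ ∈ codiscreteWithin D) (hfg : ∀ z ∈ D, g z = 0 → f z ≠ 0) :
    ∃ a b : ℂ → ℂ, DifferentiableOn ℂ a D ∧ DifferentiableOn ℂ b D ∧
      ∀ z ∈ D, a z * f z + b z * g z = 1 := by
  have hfa : ∀ z ∈ D, AnalyticAt ℂ f z := fun z hz => hf.analyticAt (hD.mem_nhds hz)
  have hga : ∀ z ∈ D, AnalyticAt ℂ g z := fun z hz => hg.analyticAt (hD.mem_nhds hz)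
  have hZD : {z ∈ D | g z = 0} ⊆ D := Set.sep_subset _ _
  obtain ⟨m, hm, hmZ⟩ := exists_mittagLeffler hD hZD
    (countable_of_compl_mem_codiscreteWithin hZD hZ) hZ (φ := fun z => (f z * g z)⁻¹)
    fun ζ hζ => ((hfa ζ hζ.1).mul (hga ζ hζ.1)).meromorphicAt.inv
  have hg0 : ∀ z ∈ D, ∀ᶠ w in 𝓝[≠] z, g w ≠ 0 := fun z hz => by
    have h1 := mem_codiscreteWithin_iff_forall_mem_nhdsNE.1 hZ z hz
    filter_upwards [h1, nhdsWithin_le_nhds (hD.mem_nhds hz)] with w hw hwD hw0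
    simp_all
  obtain ⟨a, ha, haev⟩ := exists_differentiableOn_of_punctured (D := D)
    (a₀ := fun z => g z * m z) fun z hz => by
      by_cases h0 : g z = 0
      · obtain ⟨r, hr, hrev⟩ := hmZ z ⟨hz, h0⟩
        refine ⟨fun w => (f w)⁻¹ + g w * r w,
          ((hfa z hz).inv (hfg z hz h0)).add ((hga z hz).mul hr), ?_⟩
        filter_upwards [hrev, hg0 z hz, ((hfa z hz).continuousAt.eventually_ne
          (hfg z hz h0)).filter_mono nhdsWithin_le_nhds] with w h1 h2 h3
        rw [h1]
        field_simp
      · exact ⟨_, (hga z hz).mul (hm z ⟨hz, fun h => h0 h.2⟩), .of_forall fun _ => rfl⟩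
  obtain ⟨b, hb, hbev⟩ := exists_differentiableOn_of_punctured (D := D)
    (a₀ := fun z => (1 - g z * m z * f z) / g z) fun z hz => by
      by_cases h0 : g z = 0
      · obtain ⟨r, hr, hrev⟩ := hmZ z ⟨hz, h0⟩
        refine ⟨fun w => -(f w * r w), ((hfa z hz).mul hr).neg, ?_⟩
        filter_upwards [hrev, hg0 z hz, ((hfa z hz).continuousAt.eventually_ne
          (hfg z hz h0)).filter_mono nhdsWithin_le_nhds] with w h1 h2 h3
        rw [h1]
        field_simp
        ring
      · exact ⟨_, (analyticAt_const.sub (((hga z hz).mul (hm z ⟨hz, fun h => h0 h.2⟩)).mul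
          (hfa z hz))).div (hga z hz) h0, .of_forall fun _ => rfl⟩
  refine ⟨a, b, ha, hb, fun z hz => ?_⟩
  have hc : ContinuousAt (fun w => a w * f w + b w * g w) z :=
    (((ha.mul hf).add (hb.mul hg)).differentiableAt (hD.mem_nhds hz)).continuousAt
  refine tendsto_nhds_unique (hc.tendsto.mono_left (nhdsWithin_le_nhds (s := {z}ᶜ))) ?_
  refine tendsto_const_nhds.congr' ?_
  filter_upwards [haev z hz, hbev z hz, hg0 z hz] with w h1 h2 h3
  rw [h1, h2]
  field_simp
  ring

/-- Finitely many holomorphic functions without common zeros on a planar domain generate the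
unit ideal. -/
theorem exists_bezout {D : Set ℂ} (hD : IsOpen D) (hDc : IsConnected D) {ι : Type*} [Fintype ι]
    {f : ι → ℂ → ℂ} (hf : ∀ i, DifferentiableOn ℂ (f i) D) (h0 : ∀ z ∈ D, ∃ i, f i z ≠ 0) :
    ∃ a : ι → ℂ → ℂ, (∀ i, DifferentiableOn ℂ (a i) D) ∧ ∀ z ∈ D, ∑ i, a i z * f i z = 1 := by
  classical
  obtain ⟨z₀, hz₀⟩ := hDc.nonempty
  obtain ⟨i₀, hi₀⟩ := h0 z₀ hz₀
  have hZD : {z ∈ D | f i₀ z = 0} ⊆ D := Set.sep_subset _ _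
  have hZ : {z ∈ D | f i₀ z = 0}ᶜ ∈ codiscreteWithin D := by
    refine mem_of_superset (AnalyticOnNhd.preimage_zero_mem_codiscreteWithin
      ((hf i₀).analyticOnNhd hD) hi₀ hz₀ hDc) fun z hz hz' => hz hz'.2
  have hZc := countable_of_compl_mem_codiscreteWithin hZD hZ
  let P : ℂ → Polynomial ℂ := fun z =>
    ∑ i, Polynomial.monomial (Fintype.equivFin ι i : ℕ) (f i z)
  have hcoeff : ∀ z i, (P z).coeff (Fintype.equivFin ι i) = f i z := fun z i => by
    simp only [P, Polynomial.finsetSum_coeff, Polynomial.coeff_monomial, Fin.val_inj,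
      EmbeddingLike.apply_eq_iff_eq, Finset.sum_ite_eq', Finset.mem_univ, if_true]
  have hroots : (⋃ z ∈ {z ∈ D | f i₀ z = 0}, {t : ℂ | (P z).IsRoot t}).Countable := by
    refine hZc.biUnion fun z hz => (Polynomial.finite_setOfPred_isRoot fun hP => ?_).countable
    obtain ⟨i, hi⟩ := h0 z hz.1
    rw [← hcoeff, hP, Polynomial.coeff_zero] at hi
    exact hi rfl
  obtain ⟨t, ht⟩ : ∃ t, t ∉ ⋃ z ∈ {z ∈ D | f i₀ z = 0}, {t : ℂ | (P z).IsRoot t} := by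
    by_contra! hcon
    exact not_countable_complex (hroots.mono fun t _ => hcon t)
  have heval : ∀ z, (P z).eval t = ∑ i, t ^ (Fintype.equivFin ι i : ℕ) * f i z := fun z => by
    simp [P, Polynomial.eval_finsetSum, mul_comm]
  obtain ⟨a, b, ha, hb, hab⟩ := exists_bezout_pair hD (g := f i₀)
    (f := fun z => ∑ i, t ^ (Fintype.equivFin ι i : ℕ) * f i z)
    (DifferentiableOn.fun_sum fun i _ => (hf i).const_mul _) (hf i₀) hZ fun z hz hz0 hcon => by
      refine ht (Set.mem_biUnion (show z ∈ {z ∈ D | f i₀ z = 0} from ⟨hz, hz0⟩) ?_)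
      exact (heval z).trans hcon
  refine ⟨fun i z => a z * t ^ (Fintype.equivFin ι i : ℕ) + if i = i₀ then b z else 0,
    fun i => ?_, fun z hz => ?_⟩
  · refine (ha.mul_const _).add ?_
    split_ifs
    · exact hb
    · exact differentiableOn_const 0
  · rw [← hab z hz, Finset.mul_sum]
    simp [add_mul, Finset.sum_add_distrib, mul_assoc]

lemma QSphere.mul_self {I : Quaternion ℝ} (hI : I ∈ QSphere) : I * I = -1 := by
  have : I ^ 2 = -1 := hI
  rwa [sq] at this

lemma QSphere.neg_mem {I : Quaternion ℝ} (hI : I ∈ QSphere) : -I ∈ QSphere := by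
  have : I ^ 2 = -1 := hI
  simpa [QSphere] using this

lemma QSphere.re_eq_zero {I : Quaternion ℝ} (hI : I ∈ QSphere) : I.re = 0 := by
  have h := QSphere.mul_self hI
  have h0 := congrArg QuaternionAlgebra.re h
  have h1 := congrArg QuaternionAlgebra.imI h
  have h2 := congrArg QuaternionAlgebra.imJ h
  have h3 := congrArg QuaternionAlgebra.imK h
  simp only [Quaternion.re_mul, Quaternion.imI_mul, Quaternion.imJ_mul, Quaternion.imK_mul,
    Quaternion.re_neg, Quaternion.imI_neg, Quaternion.imJ_neg, Quaternion.imK_neg,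
    Quaternion.re_one, Quaternion.imI_one, Quaternion.imJ_one, Quaternion.imK_one] at h0 h1 h2 h3
  by_contra hre
  have e1 : I.imI = 0 := mul_left_cancel₀ hre (by linarith)
  have e2 : I.imJ = 0 := mul_left_cancel₀ hre (by linarith)
  have e3 : I.imK = 0 := mul_left_cancel₀ hre (by linarith)
  rw [e1, e2, e3] at h0
  nlinarith [mul_self_nonneg I.re]

lemma toSlice_eq_smul (I : Quaternion ℝ) (w : ℂ) :
    toSlice I w = w.re • (1 : Quaternion ℝ) + w.im • I := by
  rw [toSlice, Quaternion.coe_mul_eq_smul, ← Quaternion.coe_mul_eq_smul w.re 1, mul_one]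

lemma toSlice_mul {I : Quaternion ℝ} (hI : I ∈ QSphere) (v w : ℂ) :
    toSlice I (v * w) = toSlice I v * toSlice I w := by
  simp only [toSlice_eq_smul, mul_add, add_mul, smul_mul_smul_comm, one_mul, mul_one,
    QSphere.mul_self hI, Complex.mul_re, Complex.mul_im]
  module

lemma toSlice_neg (I : Quaternion ℝ) (w : ℂ) : toSlice I (-w) = -toSlice I w := by
  simp only [toSlice_eq_smul, Complex.neg_re, Complex.neg_im]
  module

lemma toSlice_conj (I : Quaternion ℝ) (w : ℂ) :
    toSlice I (starRingEnd ℂ w) = toSlice (-I) w := by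
  simp only [toSlice_eq_smul, Complex.conj_re, Complex.conj_im]
  module

lemma mul_toSlice_of_anticomm {I J : Quaternion ℝ} (hIJ : I * J = -(J * I)) (w : ℂ) :
    J * toSlice I w = toSlice I (starRingEnd ℂ w) * J := by
  have : J * I = -(I * J) := by rw [hIJ, neg_neg]
  simp only [toSlice_eq_smul, Complex.conj_re, Complex.conj_im, mul_add, add_mul, mul_smul_comm,
    smul_mul_assoc, this, mul_one, one_mul]
  module

lemma toSlice_zero (I : Quaternion ℝ) : toSlice I 0 = 0 := by simp [toSlice]

lemma toSlice_ofReal (I : Quaternion ℝ) (x : ℝ) : toSlice I x = x := by simp [toSlice]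

lemma continuous_toSlice (I : Quaternion ℝ) : Continuous (toSlice I) := by
  simp only [funext (toSlice_eq_smul I)]
  fun_prop

/-- The slice `Ω_I` of `Ω`, viewed in `ℂ`. -/
def planarSlice (I : Quaternion ℝ) (Ω : Set (Quaternion ℝ)) : Set ℂ := {w | toSlice I w ∈ Ω}

lemma isOpen_planarSlice {Ω : Set (Quaternion ℝ)} (hΩ : IsSymmSliceDomain Ω) (I : Quaternion ℝ) :
    IsOpen (planarSlice I Ω) := hΩ.1.preimage (continuous_toSlice I)

lemma mem_planarSlice_of_mem {Ω : Set (Quaternion ℝ)} (hΩ : IsSymmSliceDomain Ω)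
    {I I' : Quaternion ℝ} (hI : I ∈ QSphere) (hI' : I' ∈ QSphere) {w : ℂ}
    (hw : w ∈ planarSlice I Ω) : w ∈ planarSlice I' Ω :=
  hΩ.2.2.2.2 w.re w.im I hI hw I' hI'

lemma conj_mem_planarSlice {Ω : Set (Quaternion ℝ)} (hΩ : IsSymmSliceDomain Ω)
    {I : Quaternion ℝ} (hI : I ∈ QSphere) {w : ℂ} (hw : w ∈ planarSlice I Ω) :
    starRingEnd ℂ w ∈ planarSlice I Ω := by
  have := mem_planarSlice_of_mem hΩ hI (QSphere.neg_mem hI) hw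
  rwa [planarSlice, Set.mem_ofPred_eq, ← toSlice_conj] at this

lemma isConnected_planarSlice {Ω : Set (Quaternion ℝ)} (hΩ : IsSymmSliceDomain Ω)
    {I : Quaternion ℝ} (hI : I ∈ QSphere) : IsConnected (planarSlice I Ω) := by
  have hre := QSphere.re_eq_zero hI
  have hcont : Continuous fun q : Quaternion ℝ => (q.re : ℂ) - (q * I).re * Complex.I := by
    have h1 : Continuous fun q : Quaternion ℝ => (q * I).re :=
      Quaternion.continuous_re.comp (continuous_id.mul continuous_const)
    have h2 := Quaternion.continuous_re
    fun_prop
  have hinv : ∀ w : ℂ, ((toSlice I w).re : ℂ) - (toSlice I w * I).re * Complex.I = w := by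
    intro w
    simp only [toSlice_eq_smul, add_mul, smul_mul_assoc, QSphere.mul_self hI, one_mul]
    apply Complex.ext <;> simp [hre, Quaternion.re_one]
  convert (hΩ.2.2.2.1 I hI).image _ hcont.continuousOn
  ext w
  constructor
  · exact fun hw => ⟨toSlice I w, ⟨hw, w.re, w.im, rfl⟩, hinv w⟩
  · rintro ⟨q, ⟨hq, x, y, rfl⟩, rfl⟩
    exact (congrArg (toSlice I · ∈ Ω) (hinv ⟨x, y⟩)).mpr hq

/-- Identity principle for quaternion-valued functions that are holomorphic for the complex
structure given by left multiplication by `I`. -/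
lemma eq_zero_of_cauchyRiemann {D : Set ℂ} (hD : IsOpen D) (hDc : IsPreconnected D)
    {x₀ : ℝ} (hx₀ : (x₀ : ℂ) ∈ D) {I : Quaternion ℝ} (hI : I ∈ QSphere)
    {g : ℝ × ℝ → Quaternion ℝ}
    (hg : ∀ w ∈ D, DifferentiableAt ℝ g (w.re, w.im) ∧
      fderiv ℝ g (w.re, w.im) (1, 0) + I * fderiv ℝ g (w.re, w.im) (0, 1) = 0)
    (h0 : ∀ x : ℝ, (x : ℂ) ∈ D → g (x, 0) = 0) {w : ℂ} (hw : w ∈ D) : g (w.re, w.im) = 0 := by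
  let reL : Quaternion ℝ →L[ℝ] ℝ := LinearMap.toContinuousLinearMap
    { toFun := QuaternionAlgebra.re, map_add' := fun _ _ => rfl, map_smul' := fun _ _ => rfl }
  let π : Quaternion ℝ → Quaternion ℝ →L[ℝ] ℂ := fun p =>
    Complex.ofRealCLM.comp (reL.comp ((ContinuousLinearMap.mul ℝ _).flip p)) -
      Complex.I • Complex.ofRealCLM.comp (reL.comp
        (((ContinuousLinearMap.mul ℝ _).flip p).comp (ContinuousLinearMap.mul ℝ _ I)))
  have hπ : ∀ p q, π p q = ((q * p).re : ℂ) - Complex.I * ((I * q * p).re : ℂ) :=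
    fun p q => rfl
  have hπI : ∀ p q, π p (I * q) = Complex.I * π p q := by
    intro p q
    rw [hπ, hπ, ← mul_assoc I I q, QSphere.mul_self hI, mul_sub, ← mul_assoc, Complex.I_mul_I]
    simp
    ring
  have hzero : ∀ p, Set.EqOn (fun w : ℂ => π p (g (w.re, w.im))) 0 D := by
    intro p
    refine AnalyticOnNhd.eqOn_zero_of_preconnected_of_frequently_eq_zero
      (DifferentiableOn.analyticOnNhd (fun w hw => ?_) hD) hDc hx₀ ?_
    · obtain ⟨hd, hcr⟩ := hg w hw
      refine DifferentiableAt.differentiableWithinAt ?_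
      have hF : HasFDerivAt (fun w : ℂ => π p (g (w.re, w.im)))
          ((π p).comp ((fderiv ℝ g (w.re, w.im)).comp (Complex.reCLM.prod Complex.imCLM))) w :=
        (π p).hasFDerivAt.comp w (hd.hasFDerivAt.comp w
          (Complex.reCLM.prod Complex.imCLM).hasFDerivAt)
      refine differentiableAt_complex_iff_differentiableAt_real.2 ⟨hF.differentiableAt, ?_⟩
      rw [hF.fderiv]
      simp only [ContinuousLinearMap.comp_apply, ContinuousLinearMap.prod_apply,
        Complex.reCLM_apply, Complex.imCLM_apply, Complex.I_re, Complex.I_im, Complex.one_re,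
        Complex.one_im, smul_eq_mul]
      rw [eq_neg_of_add_eq_zero_left hcr, map_neg, hπI, mul_neg, ← mul_assoc, Complex.I_mul_I]
      ring
    · have hcont : Tendsto (fun x : ℝ => (x : ℂ)) (𝓝[≠] x₀) (𝓝[≠] (x₀ : ℂ)) :=
        tendsto_nhdsWithin_of_tendsto_nhds_of_eventually_within _
          (Complex.continuous_ofReal.continuousAt.tendsto.mono_left nhdsWithin_le_nhds)
          (eventually_nhdsWithin_of_forall fun x hx => by simpa using hx)
      refine hcont.frequently (Eventually.frequently ?_)
      have hD' : ∀ᶠ x : ℝ in 𝓝[≠] x₀, (x : ℂ) ∈ D :=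
        hcont.eventually (nhdsWithin_le_nhds (hD.mem_nhds hx₀))
      filter_upwards [hD'] with x hx
      simp [h0 x hx]
  have h1 := congrArg Complex.re (hzero (star (g (w.re, w.im))) hw)
  simp only [hπ] at h1
  rw [Quaternion.self_mul_star] at h1
  have h2 : (I * g (w.re, w.im) * star (g (w.re, w.im))).re = 0 := by
    rw [mul_assoc, Quaternion.self_mul_star, Quaternion.mul_coe_eq_smul]
    simp [QSphere.re_eq_zero hI]
  rw [h2] at h1
  simpa using h1

/-- Representation formula for slice regular functions. -/
lemma SliceRegularOn.representation {Ω : Set (Quaternion ℝ)} (hΩ : IsSymmSliceDomain Ω)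
    {f : Quaternion ℝ → Quaternion ℝ} (hf : SliceRegularOn f Ω) {I I' : Quaternion ℝ}
    (hI : I ∈ QSphere) (hI' : I' ∈ QSphere) {w : ℂ} (hw : w ∈ planarSlice I Ω) :
    (2 : ℝ) • f (toSlice I' w) =
      (1 - I' * I) * f (toSlice I w) + (1 + I' * I) * f (toSlice I (starRingEnd ℂ w)) := by
  obtain ⟨x₀, hx₀⟩ := hΩ.2.2.1
  have key := eq_zero_of_cauchyRiemann (isOpen_planarSlice hΩ I)
    (isConnected_planarSlice hΩ hI).isPreconnected (x₀ := x₀)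
    (by rwa [planarSlice, Set.mem_ofPred_eq, toSlice_ofReal]) hI'
    (g := fun p => (2 : ℝ) • sliceMap f I' p -
      ((1 - I' * I) * sliceMap f I p + (1 + I' * I) * sliceMap f (-I) p)) ?_ ?_ hw
  · rw [toSlice_conj]
    exact sub_eq_zero.1 key
  · intro v hv
    obtain ⟨hd', hcr'⟩ := hf I' hI' v.re v.im (mem_planarSlice_of_mem hΩ hI hI' hv)
    obtain ⟨hd, hcr⟩ := hf I hI v.re v.im hv
    obtain ⟨hdn, hcrn⟩ := hf (-I) (QSphere.neg_mem hI) v.re v.im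
      (mem_planarSlice_of_mem hΩ hI (QSphere.neg_mem hI) hv)
    have hF := ((hd'.differentiableAt one_ne_zero).hasFDerivAt.const_smul (2 : ℝ)).sub
      (((hd.differentiableAt one_ne_zero).hasFDerivAt.const_mul (1 - I' * I)).add
        ((hdn.differentiableAt one_ne_zero).hasFDerivAt.const_mul (1 + I' * I)))
    refine ⟨hF.differentiableAt, ?_⟩
    erw [hF.fderiv]
    have hII := QSphere.mul_self hI
    have hII' := QSphere.mul_self hI'
    simp only [_root_.sub_apply, _root_.add_apply, _root_.smul_apply, smul_eq_mul]
    rw [eq_neg_of_add_eq_zero_left hcr', eq_neg_of_add_eq_zero_left hcr,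
      eq_neg_of_add_eq_zero_left hcrn]
    generalize fderiv ℝ (sliceMap f I') (v.re, v.im) (0, 1) = a
    generalize fderiv ℝ (sliceMap f I) (v.re, v.im) (0, 1) = b
    generalize fderiv ℝ (sliceMap f (-I)) (v.re, v.im) (0, 1) = c
    have e1 : ∀ q, I * (I * q) = -q := fun q => by rw [← mul_assoc, hII, neg_one_mul]
    have e2 : ∀ q, I' * (I' * q) = -q := fun q => by rw [← mul_assoc, hII', neg_one_mul]
    simp only [mul_add, add_mul, sub_mul, mul_sub, mul_neg, neg_mul, mul_assoc, one_mul, e1, e2,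
      mul_smul_comm, smul_neg, neg_neg]
    abel
  · intro x hx
    simp only [sliceMap, Quaternion.coe_zero, zero_mul, add_zero, ← add_mul]
    rw [sub_add_add_cancel, two_smul, one_add_one_eq_two, two_mul, sub_self]

/-- If the values at `w` and `conj w` of slice regular functions are related by left multiplication
by a common `u` that anticommutes with `I` and has nonpositive real square, then the functions have
a common zero. -/
lemma exists_common_zero {Ω : Set (Quaternion ℝ)} (hΩ : IsSymmSliceDomain Ω) {ι : Type*}
    {f : ι → Quaternion ℝ → Quaternion ℝ} (hf : ∀ i, SliceRegularOn (f i) Ω) {I u : Quaternion ℝ}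
    (hI : I ∈ QSphere) {w : ℂ} (hw : w ∈ planarSlice I Ω) (huI : u * I = -(I * u))
    {c : ℝ} (hc : 0 ≤ c) (hu : u * u = -(c • (1 : Quaternion ℝ)))
    (h : ∀ i, f i (toSlice I (starRingEnd ℂ w)) = u * f i (toSlice I w)) :
    ∃ q ∈ Ω, ∀ i, f i q = 0 := by
  have hc' : (1 + c) ≠ 0 := by positivity
  have hII := QSphere.mul_self hI
  have hsq : (1 + u) * (1 + u) = (1 - c) • (1 : Quaternion ℝ) + (2 : ℝ) • u := by
    rw [add_mul, mul_add, mul_add, hu, one_mul, mul_one, one_mul]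
    module
  set I' : Quaternion ℝ := -((1 + c)⁻¹ • ((1 + u) * (1 + u) * I)) with hI'def
  have hI' : I' ∈ QSphere := by
    change I' ^ 2 = -1
    rw [sq, hI'def, neg_mul_neg, smul_mul_smul_comm]
    have h1 : I * (u * I) = u := by rw [huI, mul_neg, ← mul_assoc, hII, neg_one_mul, neg_neg]
    have : (1 + u) * (1 + u) * I * ((1 + u) * (1 + u) * I) = -((1 + c) * (1 + c)) • 1 := by
      simp only [hsq, add_mul, mul_add, one_mul, mul_one, smul_mul_assoc, mul_smul_comm,
        mul_assoc, h1, hII, hu, mul_neg]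
      module
    rw [this, smul_smul]
    field_simp
    simp
  have hzero : (1 - I' * I) + (1 + I' * I) * u = 0 := by
    have hI'I : I' * I = (1 + c)⁻¹ • ((1 + u) * (1 + u)) := by
      rw [hI'def, neg_mul, smul_mul_assoc, mul_assoc _ I I, hII, mul_neg_one, smul_neg, neg_neg]
    rw [hI'I]
    have : (1 + c) • (1 - (1 + c)⁻¹ • ((1 + u) * (1 + u)) +
        (1 + (1 + c)⁻¹ • ((1 + u) * (1 + u))) * u) = 0 := by
      simp only [hsq, smul_add, smul_sub, add_mul, smul_mul_assoc, smul_inv_smul₀ hc', one_mul, hu]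
      module
    exact (smul_eq_zero.1 this).resolve_left hc'
  refine ⟨toSlice I' w, mem_planarSlice_of_mem hΩ hI hI' hw, fun i => ?_⟩
  have := (hf i).representation hΩ hI hI' hw
  rw [h i, ← mul_assoc, ← add_mul, hzero, zero_mul] at this
  exact (smul_eq_zero.1 this).resolve_left two_ne_zero

lemma hatC_hatC (h : ℂ → ℂ) : hatC (hatC h) = h := by
  ext w
  simp [hatC]

lemma DifferentiableOn.hatC {Ω : Set (Quaternion ℝ)} (hΩ : IsSymmSliceDomain Ω)
    {I : Quaternion ℝ} (hI : I ∈ QSphere) {h : ℂ → ℂ}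
    (hh : DifferentiableOn ℂ h (planarSlice I Ω)) :
    DifferentiableOn ℂ (hatC h) (planarSlice I Ω) := by
  intro w hw
  have := (hh.differentiableAt
    ((isOpen_planarSlice hΩ I).mem_nhds (conj_mem_planarSlice hΩ hI hw))).conj_conj
  rw [Complex.conj_conj] at this
  exact this.differentiableWithinAt

/-- A `2 × m` holomorphic linear system of maximal rank is solvable on a planar domain. -/
lemma exists_solution_of_minors {D : Set ℂ} (hD : IsOpen D) (hDc : IsConnected D) {ι : Type*}
    [Fintype ι] {c d : ι → ℂ → ℂ} (hc : ∀ i, DifferentiableOn ℂ (c i) D)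
    (hd : ∀ i, DifferentiableOn ℂ (d i) D)
    (hrank : ∀ w ∈ D, ∃ i j, c i w * d j w - c j w * d i w ≠ 0) :
    ∃ U : ι → ℂ → ℂ, (∀ i, DifferentiableOn ℂ (U i) D) ∧
      ∀ w ∈ D, ∑ i, c i w * U i w = 1 ∧ ∑ i, d i w * U i w = 0 := by
  obtain ⟨a, ha, hsum⟩ := exists_bezout hD hDc (ι := ι × ι)
    (f := fun p w => c p.1 w * d p.2 w - c p.2 w * d p.1 w)
    (fun p => ((hc p.1).mul (hd p.2)).sub ((hc p.2).mul (hd p.1)))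
    fun w hw => by simpa using hrank w hw
  refine ⟨fun i w => ∑ j, (a (i, j) w - a (j, i) w) * d j w, fun i =>
    DifferentiableOn.fun_sum fun j _ => ((ha _).sub (ha _)).mul (hd j), fun w hw => ⟨?_, ?_⟩⟩
  · rw [← hsum w hw, Fintype.sum_prod_type]
    simp only [Finset.mul_sum, sub_mul, mul_sub, Finset.sum_sub_distrib]
    congr 1
    · exact Finset.sum_congr rfl fun i _ => Finset.sum_congr rfl fun j _ => by ring
    · rw [Finset.sum_comm]
      exact Finset.sum_congr rfl fun i _ => Finset.sum_congr rfl fun j _ => by ring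
  · simp only [Finset.mul_sum, sub_mul, mul_sub, Finset.sum_sub_distrib]
    rw [sub_eq_zero, Finset.sum_comm]
    exact Finset.sum_congr rfl fun i _ => Finset.sum_congr rfl fun j _ => by ring

/-- Global solvability on a slice: if `f₁, …, fₙ` are slice regular on a symmetric slice
domain `Ω` without common zeros, and `f_ℓ = F_ℓ + G_ℓ J` is a splitting on `Ω_I`
(the slice `Ω_I` being identified with a subset of `ℂ` via `toSlice I`), then there
are holomorphic `H_ℓ, K_ℓ` on `Ω_I` with `Σ (F_ℓ H_ℓ − G_ℓ K̂_ℓ) = 1` and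
`Σ (F_ℓ K_ℓ + G_ℓ Ĥ_ℓ) = 0` on `Ω_I`. -/
theorem global_splitting_solution_on_slice
    (Ω : Set (Quaternion ℝ)) (hΩ : IsSymmSliceDomain Ω)
    (n : ℕ) (f : Fin n → Quaternion ℝ → Quaternion ℝ)
    (hreg : ∀ ℓ, SliceRegularOn (f ℓ) Ω)
    (hnz : ∀ q ∈ Ω, ∃ ℓ, f ℓ q ≠ 0)
    (I J : Quaternion ℝ) (hI : I ∈ QSphere) (hJ : J ∈ QSphere)
    (hIJ : I * J = -(J * I))
    (F G : Fin n → ℂ → ℂ)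
    (hF : ∀ ℓ, DifferentiableOn ℂ (F ℓ) {w : ℂ | toSlice I w ∈ Ω})
    (hG : ∀ ℓ, DifferentiableOn ℂ (G ℓ) {w : ℂ | toSlice I w ∈ Ω})
    (hsplit : ∀ ℓ, ∀ w : ℂ, toSlice I w ∈ Ω →
      f ℓ (toSlice I w) = toSlice I (F ℓ w) + toSlice I (G ℓ w) * J) :
    ∃ H K : Fin n → ℂ → ℂ,
      (∀ ℓ, DifferentiableOn ℂ (H ℓ) {w : ℂ | toSlice I w ∈ Ω} ∧
            DifferentiableOn ℂ (K ℓ) {w : ℂ | toSlice I w ∈ Ω}) ∧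
      ∀ w : ℂ, toSlice I w ∈ Ω →
        (∑ ℓ, (F ℓ w * H ℓ w - G ℓ w * hatC (K ℓ) w)) = 1 ∧
        (∑ ℓ, (F ℓ w * K ℓ w + G ℓ w * hatC (H ℓ) w)) = 0 := by
  change ∀ ℓ, DifferentiableOn ℂ (F ℓ) (planarSlice I Ω) at hF
  change ∀ ℓ, DifferentiableOn ℂ (G ℓ) (planarSlice I Ω) at hG
  have hD := isOpen_planarSlice hΩ I
  have hhat : ∀ {h : ℂ → ℂ}, DifferentiableOn ℂ h (planarSlice I Ω) →
      DifferentiableOn ℂ (hatC h) (planarSlice I Ω) := DifferentiableOn.hatC hΩ hI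
  let c : Fin n ⊕ Fin n → ℂ → ℂ := Sum.elim F fun ℓ => -G ℓ
  let d : Fin n ⊕ Fin n → ℂ → ℂ := Sum.elim (fun ℓ => hatC (G ℓ)) fun ℓ => hatC (F ℓ)
  have hc : ∀ i, DifferentiableOn ℂ (c i) (planarSlice I Ω) :=
    Sum.rec hF fun ℓ => (hG ℓ).neg
  have hd : ∀ i, DifferentiableOn ℂ (d i) (planarSlice I Ω) :=
    Sum.rec (fun ℓ => hhat (hG ℓ)) fun ℓ => hhat (hF ℓ)
  obtain ⟨U, hU, hUeq⟩ := exists_solution_of_minors hD (isConnected_planarSlice hΩ hI) hc hd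
    fun w hw => by
      by_contra! hcon
      obtain ⟨i₀, hi₀⟩ : ∃ i, c i w ≠ 0 := by
        by_contra! hzero
        obtain ⟨ℓ, hℓ⟩ := hnz _ hw
        have hFz : F ℓ w = 0 := hzero (.inl ℓ)
        have hGz : G ℓ w = 0 := neg_eq_zero.1 (hzero (.inr ℓ))
        rw [hsplit ℓ w hw, hFz, hGz, toSlice_zero, zero_mul, add_zero] at hℓ
        exact hℓ rfl
      have hprop : ∀ i, d i w = d i₀ w / c i₀ w * c i w := fun i => by
        have := hcon i₀ i
        field_simp
        linear_combination this
      set μ := starRingEnd ℂ (d i₀ w / c i₀ w) with hμ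
      have hG' : ∀ ℓ, G ℓ (starRingEnd ℂ w) = μ * starRingEnd ℂ (F ℓ w) := fun ℓ => by
        have := congrArg (starRingEnd ℂ) (hprop (.inl ℓ))
        simpa only [c, d, Sum.elim_inl, hatC, Complex.conj_conj, map_mul] using this
      have hF' : ∀ ℓ, F ℓ (starRingEnd ℂ w) = -(μ * starRingEnd ℂ (G ℓ w)) := fun ℓ => by
        have := congrArg (starRingEnd ℂ) (hprop (.inr ℓ))
        simpa only [c, d, Sum.elim_inr, hatC, Complex.conj_conj, map_mul, Pi.neg_apply, map_neg,
          mul_neg] using this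
      have hJJ := QSphere.mul_self hJ
      have hcomm := mul_toSlice_of_anticomm hIJ
      obtain ⟨q, hq, hq0⟩ := exists_common_zero hΩ hreg hI (u := toSlice I μ * J) hw
        (c := Complex.normSq μ)
        (by
          have h1 : toSlice I μ * I = I * toSlice I μ := by
            simp only [toSlice_eq_smul, add_mul, mul_add, smul_mul_assoc, mul_smul_comm, one_mul,
              mul_one]
          have h2 : J * I = -(I * J) := by rw [hIJ, neg_neg]
          rw [mul_assoc, h2, mul_neg, ← mul_assoc, h1, mul_assoc])
        (Complex.normSq_nonneg μ)
        (by
          rw [mul_assoc, ← mul_assoc J, hcomm, mul_assoc _ J J, hJJ, mul_neg_one, mul_neg,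
            ← toSlice_mul hI, Complex.mul_conj, toSlice_ofReal, ← Quaternion.coe_mul_eq_smul,
            mul_one])
        (fun ℓ => by
          rw [hsplit ℓ w hw, hsplit ℓ _ (conj_mem_planarSlice hΩ hI hw), hF', hG', mul_add,
            toSlice_neg, toSlice_mul hI, toSlice_mul hI, mul_assoc (toSlice I μ) J, hcomm,
            mul_assoc (toSlice I μ) J, ← mul_assoc J, hcomm, mul_assoc _ J J, hJJ, mul_neg_one,
            mul_neg, mul_assoc]
          abel)
      obtain ⟨ℓ, hℓ⟩ := hnz q hq
      exact hℓ (hq0 ℓ)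
  refine ⟨fun ℓ => U (.inl ℓ), fun ℓ => hatC (U (.inr ℓ)), fun ℓ => ⟨hU _, hhat (hU _)⟩,
    fun w hw => ⟨?_, ?_⟩⟩
  · have := (hUeq w hw).1
    rw [Fintype.sum_sum_type] at this
    simp only [c, Sum.elim_inl, Sum.elim_inr, Pi.neg_apply] at this
    simp only [hatC_hatC]
    rw [← this, ← Finset.sum_add_distrib]
    exact Finset.sum_congr rfl fun ℓ _ => by ring
  · have := (hUeq _ (conj_mem_planarSlice hΩ hI hw)).2
    rw [Fintype.sum_sum_type, ← Finset.sum_add_distrib] at this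
    simp only [d, Sum.elim_inl, Sum.elim_inr] at this
    have := congrArg (starRingEnd ℂ) this
    rw [map_sum, map_zero] at this
    rw [← this]
    refine Finset.sum_congr rfl fun ℓ _ => ?_
    simp only [hatC, map_add, map_mul, Complex.conj_conj]
    ring
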